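/- Let m: ℕ → ℕ satisfy 2 ≤ m(n) ≤ n for all n ≥ 2. Then: (1) lim_{n→∞} Pr(S^R(m(n),n) < m(n)) = 0, i.e. with probability tending to one Row eliminates no action; (2) if m(n)/ln n → 0, then lim_{n→∞} ((m(n)−1)!/(ln n)^{m(n)−1}) · E[S^C(m(n),n)] = 1 and lim_{n→∞} E[S^C(m(n),n)]/n = 0; (3) if m(n) − log₂ n → ∞, then lim_{n→∞} E[S^C(m(n),n)]/n = 1. -/

import Mathlib

open Finset Filter

noncomputable section

/-- Row action `i` is strictly dominated in the restricted game with Row actions `X`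
and Column actions `Y`, for Row payoff matrix `R`. -/
def RowDomIn {m n : ℕ} (R : Fin m → Fin n → ℝ) (X : Finset (Fin m)) (Y : Finset (Fin n))
    (i : Fin m) : Prop :=
  ∃ i' ∈ X, ∀ j ∈ Y, R i j < R i' j

/-- Column action `j` is strictly dominated in the restricted game with Row actions `X`
and Column actions `Y`, for Column payoff matrix `C`. -/
def ColDomIn {m n : ℕ} (C : Fin m → Fin n → ℝ) (X : Finset (Fin m)) (Y : Finset (Fin n))
    (j : Fin n) : Prop :=
  ∃ j' ∈ Y, ∀ i ∈ X, C i j < C i j'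

open Classical in
/-- One round of iterated elimination: simultaneously delete every strictly dominated
action of both players in the current restricted game. -/
def elimStep {m n : ℕ} (R C : Fin m → Fin n → ℝ)
    (p : Finset (Fin m) × Finset (Fin n)) : Finset (Fin m) × Finset (Fin n) :=
  (p.1.filter fun i => ¬ RowDomIn R p.1 p.2 i,
   p.2.filter fun j => ¬ ColDomIn C p.1 p.2 j)

/-- Surviving actions of the subgame `(p.1, p.2)` after iterated elimination of strictly
dominated actions (iterating `m + n` times surely reaches the fixed point). -/
def survivorsFrom {m n : ℕ} (R C : Fin m → Fin n → ℝ)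
    (p : Finset (Fin m) × Finset (Fin n)) : Finset (Fin m) × Finset (Fin n) :=
  (elimStep R C)^[m + n] p

/-- The subgame `(p.1, p.2)` is strict-dominance solvable: exactly one action of each
player survives iterated elimination of strictly dominated actions. -/
def SolvableFrom {m n : ℕ} (R C : Fin m → Fin n → ℝ)
    (p : Finset (Fin m) × Finset (Fin n)) : Prop :=
  (survivorsFrom R C p).1.card = 1 ∧ (survivorsFrom R C p).2.card = 1

/-- Surviving actions of the full game after iterated elimination. -/
def survivors {m n : ℕ} (R C : Fin m → Fin n → ℝ) : Finset (Fin m) × Finset (Fin n) :=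
  survivorsFrom R C (Finset.univ, Finset.univ)

/-- The game is strict-dominance solvable. -/
def Solvable {m n : ℕ} (R C : Fin m → Fin n → ℝ) : Prop :=
  SolvableFrom R C (Finset.univ, Finset.univ)

/-- The number of rounds performed by the iterated elimination procedure:
the least `k` such that round `k + 1` deletes nothing more. -/
def elimRounds {m n : ℕ} (R C : Fin m → Fin n → ℝ) : ℕ :=
  sInf {k | (elimStep R C)^[k + 1] (Finset.univ, Finset.univ)
          = (elimStep R C)^[k] (Finset.univ, Finset.univ)}

/-- Sample space of the random game `G(m,n)`: for each Column action an i.i.d. uniform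
permutation giving Row's ordinal payoffs in that column, and for each Row action an
i.i.d. uniform permutation giving Column's ordinal payoffs in that row. -/
abbrev Omega (m n : ℕ) := (Fin n → Equiv.Perm (Fin m)) × (Fin m → Equiv.Perm (Fin n))

/-- Row's payoff matrix of the realized game. -/
def RPay {m n : ℕ} (ω : Omega m n) : Fin m → Fin n → ℝ := fun i j => ((ω.1 j) i : ℕ)

/-- Column's payoff matrix of the realized game. -/
def CPay {m n : ℕ} (ω : Omega m n) : Fin m → Fin n → ℝ := fun i j => ((ω.2 i) j : ℕ)

/-- Probability of an event under the uniform distribution on `Omega m n`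
(i.e. all `m + n` permutations uniform and mutually independent). -/
def Pr {m n : ℕ} (E : Set (Omega m n)) : ℝ :=
  (E.toFinite.toFinset.card : ℝ) / (Fintype.card (Omega m n) : ℝ)

open Classical in
/-- Number of Row actions that are not strictly dominated. -/
def UR {m n : ℕ} (ω : Omega m n) : ℕ :=
  (Finset.univ.filter fun i => ¬ RowDomIn (RPay ω) Finset.univ Finset.univ i).card

open Classical in
/-- Number of Column actions that are not strictly dominated. -/
def UC {m n : ℕ} (ω : Omega m n) : ℕ :=
  (Finset.univ.filter fun j => ¬ ColDomIn (CPay ω) Finset.univ Finset.univ j).card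

/-- Number of Row actions surviving iterated elimination. -/
def SR {m n : ℕ} (ω : Omega m n) : ℕ := (survivors (RPay ω) (CPay ω)).1.card

/-- Number of Column actions surviving iterated elimination. -/
def SC {m n : ℕ} (ω : Omega m n) : ℕ := (survivors (RPay ω) (CPay ω)).2.card

/-- The realized game is strict-dominance solvable. -/
def GameSolvable {m n : ℕ} (ω : Omega m n) : Prop := Solvable (RPay ω) (CPay ω)

/-- Number of rounds of the iterated elimination procedure in the realized game. -/
def GameRounds {m n : ℕ} (ω : Omega m n) : ℕ := elimRounds (RPay ω) (CPay ω)

/-- `π(m,n)`: probability that the random game `G(m,n)` is strict-dominance solvable. -/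
def probSolvable (m n : ℕ) : ℝ := Pr {ω : Omega m n | GameSolvable ω}

/-- Expected number of Column's strictly undominated actions, `E[U^C(m,n)]`. -/
def expUC (m n : ℕ) : ℝ :=
  (∑ ω : Omega m n, (UC ω : ℝ)) / (Fintype.card (Omega m n) : ℝ)

/-- Expected number of Column actions surviving iterated elimination, `E[S^C(m,n)]`. -/
def expSC (m n : ℕ) : ℝ :=
  (∑ ω : Omega m n, (SC ω : ℝ)) / (Fintype.card (Omega m n) : ℝ)

open Classical in
/-- `E[I(m,n)]`: expected number of elimination rounds conditional on the game being
strict-dominance solvable. -/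
def condExpRounds (m n : ℕ) : ℝ :=
  (∑ ω : Omega m n, if GameSolvable ω then (GameRounds ω : ℝ) else 0) /
    (∑ ω : Omega m n, if GameSolvable ω then (1 : ℝ) else 0)

/-- Unsigned Stirling numbers of the first kind. -/
def stirling1 : ℕ → ℕ → ℕ
  | 0, 0 => 1
  | 0, _ + 1 => 0
  | _ + 1, 0 => 0
  | n + 1, k + 1 => n * stirling1 n (k + 1) + stirling1 n k

end

namespace UndominatedActions

open scoped BigOperators

noncomputable section

open Classical in
/-- The real-valued indicator of a proposition. -/
def ind (p : Prop) : ℝ := if p then 1 else 0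

lemma ind_of_true {p : Prop} (h : p) : ind p = 1 := if_pos h

lemma ind_of_false {p : Prop} (h : ¬ p) : ind p = 0 := if_neg h

lemma ind_nonneg (p : Prop) : 0 ≤ ind p := by
  by_cases h : p <;> simp [ind, h]

lemma ind_le_one (p : Prop) : ind p ≤ 1 := by
  by_cases h : p <;> simp [ind, h]

lemma ind_not (p : Prop) : ind (¬ p) = 1 - ind p := by
  by_cases h : p <;> simp [ind, h]

lemma ind_le_ind {p q : Prop} (h : p → q) : ind p ≤ ind q := by
  by_cases hp : p
  · rw [ind_of_true hp, ind_of_true (h hp)]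
  · rw [ind_of_false hp]; exact ind_nonneg q

lemma prod_ind {ι : Type*} (s : Finset ι) (p : ι → Prop) :
    ∏ i ∈ s, ind (p i) = ind (∀ i ∈ s, p i) := by
  classical
  by_cases h : ∀ i ∈ s, p i
  · rw [ind_of_true h, Finset.prod_eq_one fun i hi => ind_of_true (h i hi)]
  · rw [ind_of_false h]
    push Not at h
    obtain ⟨i, hi, hp⟩ := h
    exact Finset.prod_eq_zero hi (ind_of_false hp)

lemma ind_exists_le_sum {ι : Type*} (s : Finset ι) (p : ι → Prop) :
    ind (∃ i ∈ s, p i) ≤ ∑ i ∈ s, ind (p i) := by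
  by_cases h : ∃ i ∈ s, p i
  · obtain ⟨i, hi, hp⟩ := h
    refine (ind_le_one _).trans ?_
    rw [← ind_of_true hp]
    exact Finset.single_le_sum (f := fun i => ind (p i)) (fun i _ => ind_nonneg (p i)) hi
  · rw [ind_of_false h]
    exact Finset.sum_nonneg fun i _ => ind_nonneg (p i)

lemma card_filter_eq_sum_ind {ι : Type*} (s : Finset ι) (p : ι → Prop) [DecidablePred p] :
    ((s.filter p).card : ℝ) = ∑ i ∈ s, ind (p i) := by
  rw [← Finset.sum_boole]
  refine Finset.sum_congr rfl fun i _ => ?_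
  by_cases h : p i <;> simp [ind, h]

lemma card_eq_sum_ind_mem {ι : Type*} [Fintype ι] (s : Finset ι) :
    (s.card : ℝ) = ∑ i, ind (i ∈ s) := by
  classical
  rw [← card_filter_eq_sum_ind]
  simp

open Classical in
/-- The actions `j` that no `j'` beats in every row, when the row orders are given by `σ`. -/
def undom {m n : ℕ} (σ : Fin m → Equiv.Perm (Fin n)) : Finset (Fin n) :=
  univ.filter fun j => ¬ ∃ j', ∀ i, σ i j < σ i j'

lemma mem_undom {m n : ℕ} {σ : Fin m → Equiv.Perm (Fin n)} {j : Fin n} :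
    j ∈ undom σ ↔ ∀ j', ∃ i, σ i j' ≤ σ i j := by
  simp [undom]

open Classical in
lemma card_argmin_mul {α : Type*} [LinearOrder α] {n : ℕ} (f : Fin n → α)
    (hf : Function.Injective f) (B : Finset (Fin n)) {b : Fin n} (hb : b ∈ B) :
    B.card * (univ.filter fun σ : Equiv.Perm (Fin n) => ∀ a ∈ B, f (σ b) ≤ f (σ a)).card
      = Fintype.card (Equiv.Perm (Fin n)) := by
  set S : Fin n → Finset (Equiv.Perm (Fin n)) := fun c =>
    univ.filter fun σ : Equiv.Perm (Fin n) => ∀ a ∈ B, f (σ c) ≤ f (σ a) with hS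
  have hswap : ∀ c ∈ B, ∀ a ∈ B, Equiv.swap c b a ∈ B := by
    intro c hc a ha
    rcases Equiv.swap_apply_def c b a with h
    split_ifs at h <;> rw [h] <;> assumption
  have hcard : ∀ c ∈ B, (S c).card = (S b).card := by
    intro c hc
    refine Finset.card_bij' (fun σ _ => σ * Equiv.swap c b) (fun σ _ => σ * Equiv.swap c b)
      ?_ ?_ ?_ ?_
    · intro σ hσ
      simp only [hS, mem_filter, mem_univ, true_and] at hσ ⊢
      intro a ha
      simpa using hσ _ (hswap c hc a ha)
    · intro σ hσ
      simp only [hS, mem_filter, mem_univ, true_and] at hσ ⊢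
      intro a ha
      simpa using hσ _ (hswap c hc a ha)
    · intro σ _; ext; simp
    · intro σ _; ext; simp
  have hunion : B.biUnion S = univ := by
    ext σ
    simp only [mem_biUnion, mem_univ, iff_true]
    obtain ⟨c, hc, h⟩ := B.exists_min_image (fun a => f (σ a)) ⟨b, hb⟩
    exact ⟨c, hc, by simpa [hS] using h⟩
  have hdisj : (B : Set (Fin n)).PairwiseDisjoint S := by
    intro c hc d hd hcd
    rw [Function.onFun, Finset.disjoint_left]
    intro σ h1 h2
    simp only [hS, mem_filter, mem_univ, true_and] at h1 h2
    exact hcd (σ.injective (hf (le_antisymm (h1 d hd) (h2 c hc))))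
  have h := Finset.card_biUnion hdisj
  rw [hunion, Finset.card_univ, Finset.sum_congr rfl hcard, Finset.sum_const, smul_eq_mul] at h
  exact h.symm

lemma expect_argmin {α : Type*} [LinearOrder α] {n : ℕ} (f : Fin n → α)
    (hf : Function.Injective f) (B : Finset (Fin n)) {b : Fin n} (hb : b ∈ B) :
    (𝔼 σ : Equiv.Perm (Fin n), ind (∀ a ∈ B, f (σ b) ≤ f (σ a))) = 1 / B.card := by
  classical
  have h := card_argmin_mul f hf B hb
  have hB : (B.card : ℝ) ≠ 0 := by
    exact_mod_cast (Finset.card_pos.2 ⟨b, hb⟩).ne'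
  have hN : (Fintype.card (Equiv.Perm (Fin n)) : ℝ) ≠ 0 := by
    exact_mod_cast Fintype.card_ne_zero
  rw [Fintype.expect_eq_sum_div_card, ← card_filter_eq_sum_ind, div_eq_div_iff hN hB, one_mul, ← h]
  push_cast
  rw [mul_comm]

lemma expect_forall_prod {ι κ : Type*} [Fintype ι] [DecidableEq ι] [Fintype κ]
    (P : ι → κ → Prop) :
    (𝔼 x : ι → κ, ind (∀ i, P i (x i))) = ∏ i, 𝔼 y : κ, ind (P i y) := by
  simp_rw [Fintype.expect_eq_sum_div_card]
  rw [Finset.prod_div_distrib, Fintype.prod_sum]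
  simp [prod_ind]

lemma expect_dominated_by_all {m n : ℕ} (j : Fin n) (A : Finset (Fin n)) (hj : j ∉ A) :
    (𝔼 σ : Fin m → Equiv.Perm (Fin n), ind (∀ j' ∈ A, ∀ i, σ i j < σ i j'))
      = (1 / ((A.card : ℝ) + 1)) ^ m := by
  have h := expect_forall_prod (ι := Fin m) (κ := Equiv.Perm (Fin n))
    (fun _ τ => ∀ a ∈ insert j A, τ j ≤ τ a)
  have h1 := expect_argmin (fun a : Fin n => a) (fun _ _ h => h) (insert j A)
    (mem_insert_self j A)
  simp only [h1, Finset.card_insert_of_notMem hj] at h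
  simp only [prod_const, Finset.card_univ, Fintype.card_fin, Nat.cast_add, Nat.cast_one] at h
  rw [← h]
  refine Finset.expect_congr rfl fun σ _ => congrArg ind (propext ?_)
  constructor
  · intro H i a ha
    rcases mem_insert.1 ha with rfl | ha
    · exact le_rfl
    · exact (H a ha i).le
  · intro H a ha i
    refine lt_of_le_of_ne (H i a (mem_insert_of_mem ha)) fun he => hj ?_
    rwa [(σ i).injective he]

lemma mem_undom_iff_erase {m n : ℕ} (hm : 0 < m) {σ : Fin m → Equiv.Perm (Fin n)} {j : Fin n} :
    j ∈ undom σ ↔ ∀ j' ∈ univ.erase j, ¬ ∀ i, σ i j < σ i j' := by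
  rw [mem_undom]
  constructor
  · intro h j' _ h'
    obtain ⟨i, hi⟩ := h j'
    exact absurd (h' i) (not_lt.2 hi)
  · intro h j'
    by_cases hj : j' = j
    · exact ⟨⟨0, hm⟩, by rw [hj]⟩
    · simpa using h j' (mem_erase.2 ⟨hj, mem_univ _⟩)

lemma expect_mem_undom {m n : ℕ} (hm : 0 < m) (j : Fin n) :
    (𝔼 σ : Fin m → Equiv.Perm (Fin n), ind (j ∈ undom σ))
      = ∑ k ∈ range n, (-1 : ℝ) ^ k * (n - 1).choose k * (1 / ((k : ℝ) + 1)) ^ m := by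
  have key : ∀ σ : Fin m → Equiv.Perm (Fin n), ind (j ∈ undom σ)
      = ∑ A ∈ (univ.erase j).powerset, (-1 : ℝ) ^ A.card *
          ind (∀ j' ∈ A, ∀ i, σ i j < σ i j') := by
    intro σ
    have h1 : ind (j ∈ undom σ)
        = ∏ j' ∈ univ.erase j, (1 + -ind (∀ i, σ i j < σ i j')) := by
      simp_rw [← sub_eq_add_neg, ← ind_not, prod_ind, mem_undom_iff_erase hm]
    rw [h1, Finset.prod_one_add]
    refine Finset.sum_congr rfl fun A _ => ?_
    rw [Finset.prod_neg, prod_ind]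
  have hcard : (univ.erase j : Finset (Fin n)).card = n - 1 := by simp
  have hn : n - 1 + 1 = n := Nat.sub_add_cancel (Fin.pos j)
  simp_rw [key]
  rw [Finset.expect_sum_comm]
  rw [Finset.sum_congr rfl (g := fun A : Finset (Fin n) =>
    (-1 : ℝ) ^ A.card * (1 / ((A.card : ℝ) + 1)) ^ m)]
  · rw [Finset.sum_powerset_apply_card (fun k => (-1 : ℝ) ^ k * (1 / ((k : ℝ) + 1)) ^ m), hcard, hn]
    refine Finset.sum_congr rfl fun k _ => ?_
    rw [nsmul_eq_mul]; ring
  · intro A hA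
    rw [← Finset.mul_expect, expect_dominated_by_all]
    intro hj
    exact absurd (mem_powerset.1 hA hj) (by simp)

lemma expect_card_undom {r n : ℕ} :
    (𝔼 σ : Fin (r + 1) → Equiv.Perm (Fin n), ((undom σ).card : ℝ))
      = ∑ k ∈ range n, (-1 : ℝ) ^ k * n.choose (k + 1) * (1 / ((k : ℝ) + 1)) ^ r := by
  simp_rw [card_eq_sum_ind_mem]
  rw [Finset.expect_sum_comm]
  simp_rw [expect_mem_undom (Nat.succ_pos r)]
  rcases n with _ | n
  · simp
  rw [Finset.sum_const, Finset.card_univ, Fintype.card_fin, nsmul_eq_mul, Finset.mul_sum]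
  refine Finset.sum_congr rfl fun k _ => ?_
  have h : ((n + 1 : ℕ) : ℝ) * n.choose k = (n + 1).choose (k + 1) * ((k : ℝ) + 1) := by
    exact_mod_cast Nat.add_one_mul_choose_eq n k
  have hk : ((k : ℝ) + 1) ≠ 0 := by positivity
  calc ((n + 1 : ℕ) : ℝ) * ((-1 : ℝ) ^ k * n.choose k * (1 / ((k : ℝ) + 1)) ^ (r + 1))
      = (-1 : ℝ) ^ k * (((n + 1 : ℕ) : ℝ) * n.choose k) * (1 / ((k : ℝ) + 1)) ^ (r + 1) := by ring
    _ = _ := by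
      rw [h, pow_succ]; field_simp

/-- `n * (1 - n * 2⁻ᵐ)` bounds the expected number of undominated actions from below. -/
lemma le_expect_card_undom {m : ℕ} (hm : 0 < m) (n : ℕ) :
    (n : ℝ) - n * (n * (1 / 2) ^ m) ≤
      𝔼 σ : Fin m → Equiv.Perm (Fin n), ((undom σ).card : ℝ) := by
  have h : ∀ j : Fin n, 1 - n * (1 / 2 : ℝ) ^ m ≤
      𝔼 σ : Fin m → Equiv.Perm (Fin n), ind (j ∈ undom σ) := by
    intro j
    have h1 : ∀ σ : Fin m → Equiv.Perm (Fin n),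
        1 - ∑ j' ∈ univ.erase j, ind (∀ i, σ i j < σ i j') ≤ ind (j ∈ undom σ) := by
      intro σ
      have h2 := ind_exists_le_sum (univ.erase j) fun j' => ∀ i, σ i j < σ i j'
      have h3 : (∃ j' ∈ univ.erase j, ∀ i, σ i j < σ i j') = ¬ j ∈ undom σ := by
        rw [mem_undom_iff_erase hm]; push Not; rfl
      rw [h3, ind_not] at h2
      linarith
    refine le_trans ?_ (Finset.expect_le_expect fun σ _ => h1 σ)
    rw [Finset.expect_sub_distrib, Fintype.expect_const, Finset.expect_sum_comm]
    refine sub_le_sub_left ?_ 1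
    rw [Finset.sum_congr rfl (g := fun _ => (1 / 2 : ℝ) ^ m)]
    · rw [Finset.sum_const, nsmul_eq_mul]
      refine mul_le_mul_of_nonneg_right ?_ (by positivity)
      exact_mod_cast (Finset.card_le_univ _).trans_eq (Fintype.card_fin n)
    · intro j' hj'
      have := expect_dominated_by_all (m := m) j {j'} (by simpa using (ne_of_mem_erase hj').symm)
      simp only [Finset.mem_singleton, forall_eq, Finset.card_singleton] at this
      rw [this]; norm_num
  simp_rw [card_eq_sum_ind_mem]
  rw [Finset.expect_sum_comm]
  calc (n : ℝ) - n * (n * (1 / 2) ^ m) = ∑ j : Fin n, (1 - n * (1 / 2 : ℝ) ^ m) := by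
        simp
    _ ≤ _ := Finset.sum_le_sum fun j _ => h j

lemma expect_fin_succ {κ : Type*} [Fintype κ] {k : ℕ} (f : (Fin (k + 1) → κ) → ℝ) :
    𝔼 x, f x = 𝔼 x : Fin k → κ, 𝔼 y : κ, f (Fin.cons y x) := by
  rw [← Finset.expect_product', univ_product_univ]
  refine (Fintype.expect_equiv ((Equiv.prodComm _ _).trans (Fin.consEquiv fun _ => κ)) _ _ ?_).symm
  intro x
  rfl

lemma half_pow_nonneg (k : ℕ) : (0 : ℝ) ≤ (1 / 2) ^ k := by positivity

lemma half_pow_le_of_le {a b : ℕ} (h : a ≤ b) : (1 / 2 : ℝ) ^ b ≤ (1 / 2) ^ a :=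
  pow_le_pow_of_le_one (by norm_num) (by norm_num) h

lemma expect_half_pow_undom_antitone (n : ℕ) :
    Antitone fun m => 𝔼 σ : Fin m → Equiv.Perm (Fin n), (1 / 2 : ℝ) ^ (undom σ).card := by
  refine antitone_nat_of_succ_le fun m => ?_
  rw [expect_fin_succ]
  refine Finset.expect_le_expect fun σ _ => Finset.expect_le univ_nonempty fun τ _ => ?_
  refine half_pow_le_of_le (Finset.card_le_card fun j hj => ?_)
  rw [mem_undom] at hj ⊢
  intro j'
  obtain ⟨i, hi⟩ := hj j'
  exact ⟨i.succ, by simpa using hi⟩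

/-- The actions that are the best one of some row. -/
def bestSet {m n : ℕ} (σ : Fin m → Equiv.Perm (Fin n)) : Finset (Fin n) :=
  univ.biUnion fun i => univ.filter fun j => ∀ a, σ i a ≤ σ i j

lemma mem_bestSet {m n : ℕ} {σ : Fin m → Equiv.Perm (Fin n)} {j : Fin n} :
    j ∈ bestSet σ ↔ ∃ i, ∀ a, σ i a ≤ σ i j := by
  simp [bestSet]

lemma bestSet_subset_undom {m n : ℕ} (σ : Fin m → Equiv.Perm (Fin n)) :
    bestSet σ ⊆ undom σ := by
  intro j hj
  obtain ⟨i, hi⟩ := mem_bestSet.1 hj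
  exact mem_undom.2 fun j' => ⟨i, hi j'⟩

lemma card_bestSet_le {m n : ℕ} (σ : Fin m → Equiv.Perm (Fin n)) : (bestSet σ).card ≤ m := by
  refine (Finset.card_biUnion_le_card_mul _ _ 1 fun i _ => ?_).trans_eq (by simp)
  refine Finset.card_le_one.2 fun a ha b hb => ?_
  simp only [mem_filter, mem_univ, true_and] at ha hb
  exact (σ i).injective (le_antisymm (hb a) (ha b))

lemma half_pow_bestSet_cons_le {m n : ℕ} (hn : 0 < n) (τ : Equiv.Perm (Fin n))
    (σ : Fin m → Equiv.Perm (Fin n)) :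
    (1 / 2 : ℝ) ^ (bestSet (Fin.cons τ σ : Fin (m + 1) → Equiv.Perm (Fin n))).card ≤
      (1 / 2) ^ (bestSet σ).card * (1 / 2 + 1 / 2 * ind (∃ j ∈ bestSet σ, ∀ a, τ a ≤ τ j)) := by
  classical
  have hsub : bestSet σ ⊆ bestSet (Fin.cons τ σ : Fin (m + 1) → Equiv.Perm (Fin n)) := by
    intro j hj
    obtain ⟨i, hi⟩ := mem_bestSet.1 hj
    exact mem_bestSet.2 ⟨i.succ, by simpa using hi⟩
  by_cases h : ∃ j ∈ bestSet σ, ∀ a, τ a ≤ τ j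
  · rw [ind_of_true h]
    refine (half_pow_le_of_le (Finset.card_le_card hsub)).trans_eq ?_
    norm_num
  · rw [ind_of_false h]
    have : Nonempty (Fin n) := ⟨⟨0, hn⟩⟩
    obtain ⟨j, hj⟩ := Finite.exists_max τ
    have hjn : j ∉ bestSet σ := fun hjm => h ⟨j, hjm, hj⟩
    have hle : (bestSet σ).card + 1 ≤
        (bestSet (Fin.cons τ σ : Fin (m + 1) → Equiv.Perm (Fin n))).card := by
      rw [← Finset.card_insert_of_notMem hjn]
      refine Finset.card_le_card (Finset.insert_subset ?_ hsub)
      exact mem_bestSet.2 ⟨0, by simpa using hj⟩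
    refine (half_pow_le_of_le hle).trans_eq ?_
    rw [pow_succ]; ring

lemma expect_half_pow_bestSet_le {n : ℕ} (k : ℕ) (hk : 2 * k ≤ n) :
    (𝔼 σ : Fin k → Equiv.Perm (Fin n), (1 / 2 : ℝ) ^ (bestSet σ).card) ≤ (3 / 4) ^ k := by
  induction k with
  | zero => simp [bestSet]
  | succ k ih =>
    have hn : 0 < n := by omega
    have hn' : (0 : ℝ) < n := by exact_mod_cast hn
    have hkn : (2 : ℝ) * k ≤ n := by exact_mod_cast (by omega : 2 * k ≤ n)
    have hstep : ∀ σ : Fin k → Equiv.Perm (Fin n),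
        (𝔼 τ : Equiv.Perm (Fin n),
          (1 / 2 : ℝ) ^ (bestSet (Fin.cons τ σ : Fin (k + 1) → Equiv.Perm (Fin n))).card)
        ≤ (1 / 2 : ℝ) ^ (bestSet σ).card * (3 / 4) := by
      intro σ
      refine (Finset.expect_le_expect fun τ _ => half_pow_bestSet_cons_le hn τ σ).trans ?_
      rw [← Finset.mul_expect, Finset.expect_add_distrib, Fintype.expect_const,
        ← Finset.mul_expect]
      refine mul_le_mul_of_nonneg_left ?_ (half_pow_nonneg _)
      have h1 : (𝔼 τ : Equiv.Perm (Fin n), ind (∃ j ∈ bestSet σ, ∀ a, τ a ≤ τ j)) ≤ 1 / 2 := by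
        refine (Finset.expect_le_expect fun τ _ => ind_exists_le_sum _ _).trans ?_
        rw [Finset.expect_sum_comm]
        have h2 : ∀ j : Fin n, (𝔼 τ : Equiv.Perm (Fin n), ind (∀ a, τ a ≤ τ j)) = 1 / n := by
          intro j
          have := expect_argmin (fun a : Fin n => OrderDual.toDual a) (fun _ _ h => h) univ
            (mem_univ j)
          simpa using this
        simp_rw [h2, Finset.sum_const, nsmul_eq_mul]
        have h3 : ((bestSet σ).card : ℝ) ≤ k := by exact_mod_cast card_bestSet_le σ
        rw [mul_one_div, div_le_div_iff₀ hn' two_pos]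
        linarith
      linarith
    rw [expect_fin_succ, pow_succ]
    refine (Finset.expect_le_expect fun σ _ => hstep σ).trans ?_
    rw [← Finset.expect_mul]
    exact mul_le_mul_of_nonneg_right (ih (by omega)) (by norm_num)

lemma expect_half_pow_undom_le_geometric {m n : ℕ} (hmn : m ≤ n) :
    (𝔼 σ : Fin m → Equiv.Perm (Fin n), (1 / 2 : ℝ) ^ (undom σ).card) ≤ (3 / 4) ^ (m / 2) := by
  refine (expect_half_pow_undom_antitone n (Nat.div_le_self m 2)).trans ?_
  refine le_trans ?_ (expect_half_pow_bestSet_le (n := n) (m / 2) (by omega))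
  exact Finset.expect_le_expect fun σ _ =>
    half_pow_le_of_le (Finset.card_le_card (bestSet_subset_undom σ))

/-- The right-to-left maxima of a permutation. -/
def records {n : ℕ} (τ : Equiv.Perm (Fin n)) : Finset (Fin n) :=
  univ.filter fun x => ∀ y, y ≤ x ∨ τ y ≤ τ x

lemma mem_records {n : ℕ} {τ : Equiv.Perm (Fin n)} {x : Fin n} :
    x ∈ records τ ↔ ∀ y, y ≤ x ∨ τ y ≤ τ x := by
  simp [records]

/-- The permutation with first value `p` whose other values are ordered as those of `e`. -/
def insertFirst {n : ℕ} (q : Fin (n + 1) × Equiv.Perm (Fin n)) : Equiv.Perm (Fin (n + 1)) :=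
  ((finSuccEquiv' 0).trans (Equiv.optionCongr q.2)).trans (finSuccEquiv' q.1).symm

@[simp] lemma insertFirst_zero {n : ℕ} (q : Fin (n + 1) × Equiv.Perm (Fin n)) :
    insertFirst q 0 = q.1 := by
  simp [insertFirst]

@[simp] lemma insertFirst_succ {n : ℕ} (q : Fin (n + 1) × Equiv.Perm (Fin n)) (i : Fin n) :
    insertFirst q i.succ = q.1.succAbove (q.2 i) := by
  have : (finSuccEquiv' (0 : Fin (n + 1))) i.succ = some i := by
    rw [← Fin.succAbove_zero, finSuccEquiv'_succAbove]
  simp [insertFirst, this]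

lemma insertFirst_bijective (n : ℕ) :
    Function.Bijective (insertFirst : Fin (n + 1) × Equiv.Perm (Fin n) → _) := by
  rw [Fintype.bijective_iff_injective_and_card]
  constructor
  · rintro ⟨p, e⟩ ⟨p', e'⟩ h
    have h0 : p = p' := by simpa using congrArg (fun f => f 0) h
    subst h0
    refine Prod.ext rfl (Equiv.ext fun i => ?_)
    simpa using congrArg (fun f => f i.succ) h
  · simp [Fintype.card_perm, Nat.factorial_succ]

lemma card_records_insertFirst {n : ℕ} (p : Fin (n + 1)) (e : Equiv.Perm (Fin n)) :
    (records (insertFirst (p, e))).card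
      = (records e).card + if p = Fin.last n then 1 else 0 := by
  have h0 : (∀ y, y ≤ 0 ∨ insertFirst (p, e) y ≤ insertFirst (p, e) 0) ↔ p = Fin.last n := by
    constructor
    · intro h
      by_contra hp
      obtain ⟨i, hi⟩ := Fin.exists_succAbove_eq (Ne.symm hp)
      have := h (e.symm i).succ
      simp [hi] at this
      exact hp this
    · rintro rfl y
      exact Or.inr (by simpa using Fin.le_last _)
  have hs : ∀ i : Fin n, (∀ y, y ≤ i.succ ∨ insertFirst (p, e) y ≤ insertFirst (p, e) i.succ) ↔
      ∀ y, y ≤ i ∨ e y ≤ e i := by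
    intro i
    rw [Fin.forall_fin_succ]
    simp [Fin.succAbove_le_succAbove_iff]
  rw [records, records, Fin.card_filter_univ_succ]
  simp only [h0, hs]
  split_ifs <;> simp

lemma expect_half_pow_records_succ (n : ℕ) :
    (𝔼 τ : Equiv.Perm (Fin (n + 1)), (1 / 2 : ℝ) ^ (records τ).card)
      = (2 * n + 1) / (2 * n + 2) * 𝔼 τ : Equiv.Perm (Fin n), (1 / 2 : ℝ) ^ (records τ).card := by
  rw [← Fintype.expect_bijective insertFirst (insertFirst_bijective n)
    (fun q => (1 / 2 : ℝ) ^ (records q.2).card * (if q.1 = Fin.last n then 1 / 2 else 1)),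
    ← univ_product_univ, Finset.expect_product]
  · rw [Finset.expect_comm]
    dsimp only
    rw [← Finset.expect_mul_expect univ univ
      (fun e : Equiv.Perm (Fin n) => (1 / 2 : ℝ) ^ (records e).card)
      (fun p : Fin (n + 1) => if p = Fin.last n then (1 / 2 : ℝ) else 1), mul_comm]
    congr 1
    rw [Fintype.expect_eq_sum_div_card, Fin.sum_univ_castSucc]
    have h : ∀ i : Fin n, i.castSucc ≠ Fin.last n := fun i => (Fin.castSucc_lt_last i).ne
    simp [h]
    field_simp
  · rintro ⟨p, e⟩
    rw [card_records_insertFirst]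
    split_ifs <;> simp [pow_succ]

lemma expect_half_pow_records_le (n : ℕ) :
    (𝔼 τ : Equiv.Perm (Fin n), (1 / 2 : ℝ) ^ (records τ).card) ≤ 1 / √((n : ℝ) + 1) := by
  induction n with
  | zero => simp [records]
  | succ n ih =>
    rw [expect_half_pow_records_succ]
    refine (mul_le_mul_of_nonneg_left ih (by positivity)).trans ?_
    push_cast
    rw [mul_one_div, div_div, div_le_div_iff₀ (by positivity) (by positivity), one_mul]
    have hn : (0 : ℝ) ≤ n := Nat.cast_nonneg n
    refine le_of_sq_le_sq ?_ (by positivity)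
    rw [mul_pow, mul_pow, Real.sq_sqrt (by positivity), Real.sq_sqrt (by positivity)]
    nlinarith

lemma card_undom_fin_two {n : ℕ} (σ : Fin 2 → Equiv.Perm (Fin n)) :
    (undom σ).card = (records (σ 1 * (σ 0)⁻¹)).card := by
  rw [← Finset.card_map (σ 0).toEmbedding]
  congr 1
  ext x
  rw [mem_map_equiv, mem_undom, mem_records]
  simp only [Fin.exists_fin_two, Equiv.apply_symm_apply]
  exact ⟨fun h y => by simpa using h ((σ 0).symm y), fun h j => by simpa using h (σ 0 j)⟩

lemma expect_half_pow_undom_le_rsqrt {m n : ℕ} (hm : 2 ≤ m) :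
    (𝔼 σ : Fin m → Equiv.Perm (Fin n), (1 / 2 : ℝ) ^ (undom σ).card) ≤ 1 / √((n : ℝ) + 1) := by
  refine (expect_half_pow_undom_antitone n hm).trans ?_
  simp_rw [card_undom_fin_two]
  rw [expect_fin_succ]
  refine Finset.expect_le univ_nonempty fun x _ => ?_
  refine (Fintype.expect_equiv ((Equiv.inv _).trans (Equiv.mulLeft (x 0))) _
    (fun ρ => (1 / 2 : ℝ) ^ (records ρ).card) fun ρ => rfl).trans_le ?_
  exact expect_half_pow_records_le n

/-- Some Row action is strictly dominated once the dominated Column actions are removed. -/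
def RowDominatedAfter {m n : ℕ} (ω : Omega m n) : Prop :=
  ∃ p ∈ (univ : Finset (Fin m × Fin m)), ∀ j ∈ undom ω.2, ω.1 j p.1 < ω.1 j p.2

lemma colDomIn_univ_iff {m n : ℕ} (ω : Omega m n) (j : Fin n) :
    ColDomIn (CPay ω) univ univ j ↔ j ∉ undom ω.2 := by
  simp [ColDomIn, CPay, mem_undom]

lemma elimStep_univ_snd {m n : ℕ} (ω : Omega m n) :
    (elimStep (RPay ω) (CPay ω) (univ, univ)).2 = undom ω.2 := by
  ext j
  simp [elimStep, colDomIn_univ_iff]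

lemma elimStep_of_undom_subset {m n : ℕ} {ω : Omega m n} (h : ¬ RowDominatedAfter ω)
    {Y : Finset (Fin n)} (hY : undom ω.2 ⊆ Y) :
    elimStep (RPay ω) (CPay ω) (univ, Y) =
      (univ, Y.filter fun j => ¬ ∃ j' ∈ Y, ∀ i, ω.2 i j < ω.2 i j') := by
  refine Prod.ext ?_ ?_
  · ext i
    simp only [elimStep, mem_filter, mem_univ, true_and, iff_true]
    rintro ⟨i', -, hi'⟩
    refine h ⟨(i, i'), mem_univ _, fun j hj => ?_⟩
    simpa [RPay] using hi' j (hY hj)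
  · ext j
    simp [elimStep, ColDomIn, CPay]

lemma survivors_eq {m n : ℕ} (hmn : 0 < m + n) {ω : Omega m n} (h : ¬ RowDominatedAfter ω) :
    survivors (RPay ω) (CPay ω) = (univ, undom ω.2) := by
  have h1 : elimStep (RPay ω) (CPay ω) (univ, univ) = (univ, undom ω.2) := by
    refine Prod.ext ?_ (elimStep_univ_snd ω)
    rw [elimStep_of_undom_subset h (subset_univ _)]
  have h2 : elimStep (RPay ω) (CPay ω) (univ, undom ω.2) = (univ, undom ω.2) := by
    rw [elimStep_of_undom_subset h (Finset.Subset.refl _), Finset.filter_true_of_mem]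
    rintro j hj ⟨j', -, hj'⟩
    obtain ⟨i, hi⟩ := mem_undom.1 hj j'
    exact absurd (hj' i) (not_lt.2 hi)
  obtain ⟨k, hk⟩ := Nat.exists_eq_succ_of_ne_zero hmn.ne'
  rw [survivors, survivorsFrom, hk, Function.iterate_succ_apply, h1, Function.iterate_fixed h2]

lemma elimStep_iterate_snd_subset {m n : ℕ} (R C : Fin m → Fin n → ℝ) (k : ℕ)
    (p : Finset (Fin m) × Finset (Fin n)) : ((elimStep R C)^[k] p).2 ⊆ p.2 := by
  induction k generalizing p with
  | zero => simp
  | succ k ih =>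
    rw [Function.iterate_succ_apply]
    classical
    exact (ih _).trans fun j hj => (mem_filter.1 hj).1

lemma SC_le {m n : ℕ} (hmn : 0 < m + n) (ω : Omega m n) : SC ω ≤ (undom ω.2).card := by
  obtain ⟨k, hk⟩ := Nat.exists_eq_succ_of_ne_zero hmn.ne'
  rw [SC, survivors, survivorsFrom, hk, Function.iterate_succ_apply, ← elimStep_univ_snd]
  exact Finset.card_le_card (elimStep_iterate_snd_subset _ _ _ _)

lemma le_SC {m n : ℕ} (hmn : 0 < m + n) (ω : Omega m n) :
    ((undom ω.2).card : ℝ) - (undom ω.2).card * ind (RowDominatedAfter ω) ≤ SC ω := by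
  by_cases h : RowDominatedAfter ω
  · rw [ind_of_true h]; simp
  · rw [ind_of_false h, SC, survivors_eq hmn h]; simp

lemma expect_omega {m n : ℕ} (f : Omega m n → ℝ) :
    𝔼 ω, f ω = 𝔼 σ : Fin m → Equiv.Perm (Fin n), 𝔼 ρ : Fin n → Equiv.Perm (Fin m), f (ρ, σ) := by
  rw [Finset.expect_comm, ← Finset.expect_product', univ_product_univ]

lemma expect_snd {m n : ℕ} (f : (Fin m → Equiv.Perm (Fin n)) → ℝ) :
    𝔼 ω : Omega m n, f ω.2 = 𝔼 σ, f σ := by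
  rw [expect_omega]
  simp

lemma expect_forall_lt_le {m n : ℕ} (Y : Finset (Fin n)) (i i' : Fin m) :
    (𝔼 ρ : Fin n → Equiv.Perm (Fin m), ind (∀ j ∈ Y, ρ j i < ρ j i')) ≤ (1 / 2) ^ Y.card := by
  have h := expect_forall_prod (ι := Fin n) (κ := Equiv.Perm (Fin m))
    (fun j τ => j ∈ Y → τ i < τ i')
  have hY : ∏ j : Fin n, (if j ∈ Y then (1 / 2 : ℝ) else 1) = (1 / 2) ^ Y.card := by
    rw [Finset.prod_ite_mem, univ_inter, prod_const]
  rw [h, ← hY]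
  refine Finset.prod_le_prod (fun j _ => Finset.expect_nonneg fun τ _ => ind_nonneg _) fun j _ => ?_
  split_ifs with hj
  · rcases eq_or_ne i i' with rfl | hii
    · simp [hj, ind_of_false]
    · have h2 := expect_argmin (fun a : Fin m => a) (fun _ _ h => h) {i, i'}
        (mem_insert_self i {i'})
      rw [Finset.card_pair hii] at h2
      refine le_of_le_of_eq (Finset.expect_le_expect fun τ _ => ind_le_ind fun hτ => ?_) h2
      simpa using (hτ hj).le
  · exact Finset.expect_le univ_nonempty fun τ _ => ind_le_one _

lemma expect_rowDominatedAfter_le {m n : ℕ} (f : (Fin m → Equiv.Perm (Fin n)) → ℝ)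
    (hf : ∀ σ, 0 ≤ f σ) :
    (𝔼 ω : Omega m n, f ω.2 * ind (RowDominatedAfter ω)) ≤
      m ^ 2 * 𝔼 σ : Fin m → Equiv.Perm (Fin n), f σ * (1 / 2) ^ (undom σ).card := by
  rw [expect_omega, Finset.mul_expect]
  refine Finset.expect_le_expect fun σ _ => ?_
  dsimp only
  rw [← Finset.mul_expect, mul_left_comm]
  refine mul_le_mul_of_nonneg_left ?_ (hf σ)
  refine (Finset.expect_le_expect fun ρ _ => ind_exists_le_sum _ _).trans ?_
  rw [Finset.expect_sum_comm]
  refine (Finset.sum_le_sum fun p _ => expect_forall_lt_le (undom σ) p.1 p.2).trans_eq ?_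
  simp [sq]

lemma Pr_SR_lt_le {m n : ℕ} (hmn : 0 < m + n) :
    Pr {ω : Omega m n | SR ω < m} ≤
      m ^ 2 * 𝔼 σ : Fin m → Equiv.Perm (Fin n), (1 / 2 : ℝ) ^ (undom σ).card := by
  classical
  have h := expect_rowDominatedAfter_le (m := m) (n := n) (fun _ => 1) fun _ => zero_le_one
  simp only [one_mul] at h
  refine le_trans ?_ h
  have hPr : Pr {ω : Omega m n | SR ω < m} = 𝔼 ω : Omega m n, ind (SR ω < m) := by
    rw [Fintype.expect_eq_sum_div_card, ← card_filter_eq_sum_ind, Pr]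
    congr 3
    ext ω
    simp
  rw [hPr]
  refine Finset.expect_le_expect fun ω _ => ind_le_ind fun hω => ?_
  by_contra hb
  rw [SR, survivors_eq hmn hb] at hω
  simp at hω

lemma expSC_eq (m n : ℕ) : expSC m n = 𝔼 ω : Omega m n, (SC ω : ℝ) :=
  (Fintype.expect_eq_sum_div_card _).symm

lemma expSC_le {m n : ℕ} (hmn : 0 < m + n) :
    expSC m n ≤ 𝔼 σ : Fin m → Equiv.Perm (Fin n), ((undom σ).card : ℝ) := by
  rw [expSC_eq, ← expect_snd]
  exact Finset.expect_le_expect fun ω _ => by exact_mod_cast SC_le hmn ω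

lemma le_expSC {m n : ℕ} (hmn : 0 < m + n) :
    (𝔼 σ : Fin m → Equiv.Perm (Fin n), ((undom σ).card : ℝ)) -
      m ^ 2 * (𝔼 σ : Fin m → Equiv.Perm (Fin n),
        ((undom σ).card : ℝ) * (1 / 2 : ℝ) ^ (undom σ).card) ≤ expSC m n := by
  have h := expect_rowDominatedAfter_le (m := m) (n := n) (fun σ => ((undom σ).card : ℝ))
    fun σ => Nat.cast_nonneg _
  refine (sub_le_sub_left h _).trans ?_
  rw [expSC_eq, ← expect_snd, ← Finset.expect_sub_distrib]
  exact Finset.expect_le_expect fun ω _ => le_SC hmn ω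

lemma card_undom_le {m n : ℕ} (σ : Fin m → Equiv.Perm (Fin n)) : (undom σ).card ≤ n :=
  (Finset.card_le_univ _).trans_eq (Fintype.card_fin n)

lemma sub_sq_le_expSC {m n : ℕ} (hmn : 0 < m + n) :
    (𝔼 σ : Fin m → Equiv.Perm (Fin n), ((undom σ).card : ℝ)) - m ^ 2 ≤ expSC m n := by
  refine le_trans (sub_le_sub_left ?_ _) (le_expSC hmn)
  refine mul_le_of_le_one_right (sq_nonneg (m : ℝ)) ?_
  refine Finset.expect_le univ_nonempty fun σ _ => ?_
  rw [one_div, inv_pow, ← div_eq_mul_inv, div_le_one (by positivity)]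
  exact_mod_cast Nat.lt_two_pow_self.le

lemma sub_mul_le_expSC {m n : ℕ} (hm : 0 < m) :
    (n : ℝ) - n * (n * (1 / 2) ^ m) - n *
      (m ^ 2 * 𝔼 σ : Fin m → Equiv.Perm (Fin n), (1 / 2 : ℝ) ^ (undom σ).card) ≤ expSC m n := by
  refine le_trans (sub_le_sub (le_expect_card_undom hm n) ?_) (le_expSC (by omega))
  rw [mul_left_comm]
  refine mul_le_mul_of_nonneg_left ?_ (sq_nonneg (m : ℝ))
  rw [Finset.mul_expect]
  refine Finset.expect_le_expect fun σ _ => mul_le_mul_of_nonneg_right ?_ (half_pow_nonneg _)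
  exact_mod_cast card_undom_le σ

lemma expSC_le_card {m n : ℕ} (hmn : 0 < m + n) : expSC m n ≤ n := by
  refine (expSC_le hmn).trans (Finset.expect_le univ_nonempty fun σ _ => ?_)
  exact_mod_cast card_undom_le σ

/-- The complete homogeneous symmetric polynomial of degree `r` in `1, 1/2, …, 1/n`. -/
def hsum : ℕ → ℕ → ℝ
  | 0, _ => 1
  | _ + 1, 0 => 0
  | r + 1, n + 1 => hsum (r + 1) n + 1 / ((n : ℝ) + 1) * hsum r (n + 1)

@[simp] lemma hsum_zero_left (n : ℕ) : hsum 0 n = 1 := by rw [hsum]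

@[simp] lemma hsum_succ_zero (r : ℕ) : hsum (r + 1) 0 = 0 := by rw [hsum]

lemma hsum_succ_succ (r n : ℕ) :
    hsum (r + 1) (n + 1) = hsum (r + 1) n + 1 / ((n : ℝ) + 1) * hsum r (n + 1) := by rw [hsum]

lemma hsum_nonneg (r n : ℕ) : 0 ≤ hsum r n := by
  induction r generalizing n with
  | zero => simp
  | succ r ihr =>
    induction n with
    | zero => simp
    | succ n ihn =>
      rw [hsum_succ_succ]
      have := ihr (n + 1)
      positivity

lemma sum_neg_one_pow_mul_choose (n : ℕ) :
    ∑ k ∈ range (n + 1), (-1 : ℝ) ^ k * (n + 1).choose (k + 1) = 1 := by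
  have h := Int.alternating_sum_range_choose_of_ne (n := n + 1) (by omega)
  rw [Finset.sum_range_succ'] at h
  have h' : ((∑ k ∈ range (n + 1), (-1 : ℤ) ^ (k + 1) * ((n + 1).choose (k + 1) : ℤ)
    + (-1) ^ 0 * ((n + 1).choose 0 : ℤ) : ℤ) : ℝ) = 0 := by exact_mod_cast h
  push_cast at h'
  simp only [pow_succ, mul_neg, mul_one, neg_mul, Finset.sum_neg_distrib,
    Nat.choose_zero_right, Nat.cast_one] at h'
  linarith

lemma alternating_sum_eq_hsum (r n : ℕ) :
    ∑ k ∈ range (n + 1), (-1 : ℝ) ^ k * (n + 1).choose (k + 1) * (1 / ((k : ℝ) + 1)) ^ r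
      = hsum r (n + 1) := by
  induction r generalizing n with
  | zero => simpa using sum_neg_one_pow_mul_choose n
  | succ r ihr =>
    have hrec : ∀ n : ℕ,
        ∑ k ∈ range (n + 1), (-1 : ℝ) ^ k * (n + 1).choose (k + 1) * (1 / ((k : ℝ) + 1)) ^ (r + 1)
        = ∑ k ∈ range n, (-1 : ℝ) ^ k * n.choose (k + 1) * (1 / ((k : ℝ) + 1)) ^ (r + 1)
          + 1 / ((n : ℝ) + 1) * hsum r (n + 1) := by
      intro n
      rw [← ihr, Finset.mul_sum]
      have h0 : ∑ k ∈ range n, (-1 : ℝ) ^ k * n.choose (k + 1) * (1 / ((k : ℝ) + 1)) ^ (r + 1)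
          = ∑ k ∈ range (n + 1),
              (-1 : ℝ) ^ k * n.choose (k + 1) * (1 / ((k : ℝ) + 1)) ^ (r + 1) := by
        rw [Finset.sum_range_succ, Nat.choose_succ_self]; simp
      rw [h0, ← Finset.sum_add_distrib]
      refine Finset.sum_congr rfl fun k _ => ?_
      have h : ((n : ℝ) + 1) * n.choose k = (n + 1).choose (k + 1) * ((k : ℝ) + 1) := by
        exact_mod_cast Nat.add_one_mul_choose_eq n k
      have hp : ((n + 1).choose (k + 1) : ℝ) = n.choose k + n.choose (k + 1) := by
        exact_mod_cast Nat.choose_succ_succ n k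
      have hn : ((n : ℝ) + 1) ≠ 0 := by positivity
      have hk : ((k : ℝ) + 1) ≠ 0 := by positivity
      have h1 : 1 / ((n : ℝ) + 1) * (n + 1).choose (k + 1) = n.choose k * (1 / ((k : ℝ) + 1)) := by
        field_simp
        linarith
      calc (-1 : ℝ) ^ k * (n + 1).choose (k + 1) * (1 / ((k : ℝ) + 1)) ^ (r + 1)
          = (-1 : ℝ) ^ k * n.choose (k + 1) * (1 / ((k : ℝ) + 1)) ^ (r + 1)
            + (-1 : ℝ) ^ k * (n.choose k * (1 / ((k : ℝ) + 1))) * (1 / ((k : ℝ) + 1)) ^ r := by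
            rw [hp]; ring
        _ = _ := by rw [← h1]; ring
    induction n with
    | zero => rw [hrec, hsum_succ_succ]; simp
    | succ n ihn => rw [hrec, ihn, ← hsum_succ_succ]

lemma expect_card_undom_eq_hsum {m n : ℕ} (hm : 0 < m) (hn : 0 < n) :
    (𝔼 σ : Fin m → Equiv.Perm (Fin n), ((undom σ).card : ℝ)) = hsum (m - 1) n := by
  obtain ⟨r, rfl⟩ := Nat.exists_eq_succ_of_ne_zero hm.ne'
  obtain ⟨k, rfl⟩ := Nat.exists_eq_succ_of_ne_zero hn.ne'
  rw [expect_card_undom, alternating_sum_eq_hsum]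
  simp

/-- The power sum of degree `j` in `1, 1/2, …, 1/n`. -/
def powerSum (j n : ℕ) : ℝ := ∑ k ∈ range n, (1 / ((k : ℝ) + 1)) ^ j

lemma powerSum_succ (j n : ℕ) :
    powerSum j (n + 1) = powerSum j n + (1 / ((n : ℝ) + 1)) ^ j := by
  rw [powerSum, Finset.sum_range_succ, ← powerSum]

lemma powerSum_nonneg (j n : ℕ) : 0 ≤ powerSum j n :=
  Finset.sum_nonneg fun k _ => by positivity

lemma powerSum_two_le (n : ℕ) : powerSum 2 n ≤ 2 - 1 / n := by
  induction n with
  | zero => simp [powerSum]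
  | succ n ih =>
    rw [powerSum_succ]
    rcases Nat.eq_zero_or_pos n with rfl | hn
    · simp [powerSum]; norm_num
    · have hn' : (0 : ℝ) < n := by exact_mod_cast hn
      have : (1 / ((n : ℝ) + 1)) ^ 2 ≤ 1 / n - 1 / (n + 1) := by
        rw [div_sub_div _ _ hn'.ne' (by positivity), div_pow,
          div_le_div_iff₀ (by positivity) (by positivity)]
        nlinarith
      push_cast
      linarith

lemma powerSum_le_two {j : ℕ} (hj : 2 ≤ j) (n : ℕ) : powerSum j n ≤ 2 := by
  have h1 : powerSum j n ≤ powerSum 2 n := by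
    refine Finset.sum_le_sum fun k _ => pow_le_pow_of_le_one (by positivity) ?_ hj
    rw [div_le_one (by positivity)]
    have : (0 : ℝ) ≤ k := Nat.cast_nonneg k
    linarith
  have h2 := powerSum_two_le n
  have h3 : (0 : ℝ) ≤ 1 / n := by positivity
  linarith

lemma hsum_eq_sum_antidiagonal (r n : ℕ) :
    hsum r (n + 1) = ∑ p ∈ antidiagonal r, (1 / ((n : ℝ) + 1)) ^ p.1 * hsum p.2 n := by
  induction r with
  | zero => simp
  | succ r ih =>
    rw [Finset.Nat.sum_antidiagonal_succ, hsum_succ_succ, ih, Finset.mul_sum]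
    simp only [pow_zero, one_mul, pow_succ]
    congr 1
    exact Finset.sum_congr rfl fun p _ => by ring

/-- Newton's identity for the complete homogeneous symmetric polynomials. -/
lemma succ_mul_hsum_succ (r n : ℕ) :
    ((r : ℝ) + 1) * hsum (r + 1) n
      = ∑ p ∈ antidiagonal r, powerSum (p.1 + 1) n * hsum p.2 n := by
  induction n generalizing r with
  | zero => simp [powerSum]
  | succ n ihn =>
    have hkey : ∀ r, ∑ p ∈ antidiagonal r, powerSum (p.1 + 1) (n + 1) * hsum p.2 n
        = ((r : ℝ) + 1) * hsum (r + 1) n + 1 / ((n : ℝ) + 1) * hsum r (n + 1) := by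
      intro r
      rw [ihn, hsum_eq_sum_antidiagonal, Finset.mul_sum, ← Finset.sum_add_distrib]
      exact Finset.sum_congr rfl fun p _ => by rw [powerSum_succ]; ring
    induction r with
    | zero =>
      have h := hkey 0
      simp only [Finset.Nat.antidiagonal_zero, Finset.sum_singleton, hsum_zero_left] at h ⊢
      rw [h, hsum_succ_succ]
      simp
    | succ r ihr =>
      have h := hkey (r + 1)
      rw [Finset.Nat.sum_antidiagonal_succ'] at h ⊢
      simp only [hsum_succ_succ _ n, mul_add, Finset.sum_add_distrib]
      simp only [hsum_zero_left] at h ⊢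
      have h2 : ∑ p ∈ antidiagonal r, powerSum (p.1 + 1) (n + 1) *
          (1 / ((n : ℝ) + 1) * hsum p.2 (n + 1))
          = 1 / ((n : ℝ) + 1) * (((r : ℝ) + 1) * hsum (r + 1) (n + 1)) := by
        rw [ihr, Finset.mul_sum]
        exact Finset.sum_congr rfl fun p _ => by ring
      rw [h2]
      push_cast at h ⊢
      linear_combination -h - ((r : ℝ) + 2) / ((n : ℝ) + 1) * hsum_succ_succ r n

lemma powerSum_one_mul_hsum_le (r n : ℕ) :
    powerSum 1 n * hsum r n ≤ ((r : ℝ) + 1) * hsum (r + 1) n := by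
  rw [succ_mul_hsum_succ]
  exact Finset.single_le_sum (f := fun p : ℕ × ℕ => powerSum (p.1 + 1) n * hsum p.2 n)
    (fun p _ => mul_nonneg (powerSum_nonneg _ _) (hsum_nonneg _ _))
    (show (0, r) ∈ antidiagonal r by simp)

lemma pow_div_factorial_le_hsum (r n : ℕ) : powerSum 1 n ^ r / r.factorial ≤ hsum r n := by
  induction r with
  | zero => simp
  | succ r ih =>
    have h := powerSum_one_mul_hsum_le r n
    have hr : (0 : ℝ) < r + 1 := by positivity
    have hf : (0 : ℝ) < r.factorial := by positivity
    rw [div_le_iff₀ hf] at ih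
    rw [Nat.factorial_succ, div_le_iff₀ (by positivity), pow_succ]
    push_cast
    calc powerSum 1 n ^ r * powerSum 1 n ≤ (hsum r n * r.factorial) * powerSum 1 n :=
          mul_le_mul_of_nonneg_right ih (powerSum_nonneg 1 n)
      _ = (powerSum 1 n * hsum r n) * r.factorial := by ring
      _ ≤ (((r : ℝ) + 1) * hsum (r + 1) n) * r.factorial := mul_le_mul_of_nonneg_right h hf.le
      _ = _ := by ring

lemma sum_hsum_le {r n : ℕ} (h : 2 * (r : ℝ) ≤ powerSum 1 n) :
    ∑ s ∈ range (r + 1), hsum s n ≤ 2 * hsum r n := by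
  induction r with
  | zero => simp
  | succ r ih =>
    push_cast at h
    rw [Finset.sum_range_succ]
    have h1 := ih (by linarith)
    have h2 := powerSum_one_mul_hsum_le r n
    have h3 : 2 * ((r : ℝ) + 1) * hsum r n ≤ powerSum 1 n * hsum r n :=
      mul_le_mul_of_nonneg_right h (hsum_nonneg r n)
    have h4 : 2 * hsum r n ≤ hsum (r + 1) n := by
      have hr : (0 : ℝ) < r + 1 := by positivity
      refine le_of_mul_le_mul_left ?_ hr
      linarith
    linarith

lemma succ_mul_hsum_succ_le {r n : ℕ} (h : 2 * (r : ℝ) ≤ powerSum 1 n)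
    (hH : 0 < powerSum 1 n) :
    ((r : ℝ) + 1) * hsum (r + 1) n ≤ (powerSum 1 n + 4 * r / powerSum 1 n) * hsum r n := by
  rw [succ_mul_hsum_succ]
  rcases r with _ | r
  · simp
  · rw [Finset.Nat.sum_antidiagonal_succ, add_mul]
    refine add_le_add le_rfl ?_
    have h1 : ∑ p ∈ antidiagonal r, powerSum (p.1 + 1 + 1) n * hsum p.2 n
        ≤ 2 * ∑ s ∈ range (r + 1), hsum s n := by
      rw [Finset.mul_sum,
        ← Finset.Nat.sum_antidiagonal_eq_sum_range_succ (fun s _ => 2 * hsum s n),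
        ← Finset.Nat.sum_antidiagonal_swap]
      exact Finset.sum_le_sum fun p _ =>
        mul_le_mul_of_nonneg_right (powerSum_le_two (by omega) n) (hsum_nonneg _ _)
    push_cast at h ⊢
    have h2 := sum_hsum_le (r := r) (n := n) (by linarith)
    have h3 := powerSum_one_mul_hsum_le r n
    refine (h1.trans (mul_le_mul_of_nonneg_left h2 two_pos.le)).trans ?_
    rw [div_mul_eq_mul_div, le_div_iff₀ hH]
    linarith

lemma hsum_le {r n : ℕ} (h : 2 * (r : ℝ) ≤ powerSum 1 n) (hH : 0 < powerSum 1 n) :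
    hsum r n ≤ powerSum 1 n ^ r / r.factorial * Real.exp (4 * (r / powerSum 1 n) ^ 2) := by
  set H := powerSum 1 n with hHdef
  have key : ∀ s ≤ r, hsum s n ≤ (H + 4 * r / H) ^ s / s.factorial := by
    intro s hs
    induction s with
    | zero => simp
    | succ s ih =>
      have hsr : (s : ℝ) ≤ r := by exact_mod_cast (by omega : s ≤ r)
      have h1 := ih (by omega)
      have h2 := succ_mul_hsum_succ_le (r := s) (n := n) (by linarith) hH
      rw [← hHdef] at h2
      have hs0 : (0 : ℝ) < s + 1 := by positivity
      have h3 : H + 4 * s / H ≤ H + 4 * r / H := by gcongr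
      have h4 : ((s : ℝ) + 1) * hsum (s + 1) n
          ≤ (H + 4 * r / H) * ((H + 4 * r / H) ^ s / s.factorial) :=
        h2.trans (mul_le_mul h3 h1 (hsum_nonneg s n) (by positivity))
      rw [Nat.factorial_succ, le_div_iff₀ (by positivity)]
      rw [← mul_div_assoc, le_div_iff₀ (by positivity)] at h4
      push_cast
      rw [pow_succ]
      linarith
  refine (key r le_rfl).trans ?_
  have h1 : H + 4 * r / H = H * (4 * (r / H ^ 2) + 1) := by field_simp; ring
  have h2 : (4 * (r / H ^ 2) + 1) ^ r ≤ Real.exp (4 * (r / H) ^ 2) := by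
    calc (4 * (r / H ^ 2) + 1) ^ r ≤ Real.exp (4 * (r / H ^ 2)) ^ r := by
          gcongr; exact Real.add_one_le_exp _
      _ = Real.exp (4 * (r / H) ^ 2) := by
          rw [← Real.exp_nat_mul]; congr 1; ring
  rw [h1, mul_pow, mul_div_right_comm]
  exact mul_le_mul_of_nonneg_left h2 (by positivity)

lemma powerSum_one_eq_harmonic (n : ℕ) : powerSum 1 n = (harmonic n : ℝ) := by
  simp [powerSum, harmonic]

lemma log_le_powerSum_one {n : ℕ} (hn : 0 < n) : Real.log n ≤ powerSum 1 n := by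
  rw [powerSum_one_eq_harmonic]
  refine le_trans ?_ (log_add_one_le_harmonic n)
  have hn' : (0 : ℝ) < n := by exact_mod_cast hn
  exact Real.log_le_log hn' (by push_cast; linarith)

lemma powerSum_one_le_one_add_log (n : ℕ) : powerSum 1 n ≤ 1 + Real.log n := by
  rw [powerSum_one_eq_harmonic]
  exact harmonic_le_one_add_log n

lemma le_normalized_hsum {r n : ℕ} (hL : 0 < Real.log n) :
    1 ≤ r.factorial / Real.log n ^ r * hsum r n := by
  have hn : 0 < n := by
    rcases Nat.eq_zero_or_pos n with rfl | h
    · simp at hL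
    · exact h
  have h : Real.log n ^ r ≤ powerSum 1 n ^ r := pow_le_pow_left₀ hL.le (log_le_powerSum_one hn) r
  have h1 := pow_div_factorial_le_hsum r n
  rw [div_le_iff₀ (by positivity)] at h1
  rw [div_mul_eq_mul_div, one_le_div (by positivity)]
  linarith

lemma normalized_hsum_le {r n : ℕ} (hL : 0 < Real.log n) (hr : 2 * (r : ℝ) ≤ Real.log n) :
    r.factorial / Real.log n ^ r * hsum r n ≤
      Real.exp (r / Real.log n + 4 * (r / Real.log n) ^ 2) := by
  have hn : 0 < n := by
    rcases Nat.eq_zero_or_pos n with rfl | h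
    · simp at hL
    · exact h
  set L := Real.log n with hLdef
  have hLH : L ≤ powerSum 1 n := log_le_powerSum_one hn
  have hHL : powerSum 1 n ≤ 1 + L := powerSum_one_le_one_add_log n
  set H := powerSum 1 n with hHdef
  have hH : 0 < H := hL.trans_le hLH
  have h1 := hsum_le (r := r) (n := n) (by linarith) hH
  rw [← hHdef] at h1
  have h2 : Real.exp (4 * (r / H) ^ 2) ≤ Real.exp (4 * (r / L) ^ 2) := by
    gcongr
  have h3 : (H / L) ^ r ≤ Real.exp (r / L) := by
    have : H / L ≤ Real.exp (1 / L) := by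
      refine le_trans ?_ (Real.add_one_le_exp _)
      rw [div_add_one hL.ne']
      gcongr
    calc (H / L) ^ r ≤ Real.exp (1 / L) ^ r := by gcongr
      _ = Real.exp (r / L) := by rw [← Real.exp_nat_mul, mul_one_div]
  have hf : (0 : ℝ) < r.factorial := by positivity
  calc r.factorial / L ^ r * hsum r n
      ≤ r.factorial / L ^ r * (H ^ r / r.factorial * Real.exp (4 * (r / H) ^ 2)) := by gcongr
    _ = (H / L) ^ r * Real.exp (4 * (r / H) ^ 2) := by rw [div_pow H L r]; field_simp
    _ ≤ Real.exp (r / L) * Real.exp (4 * (r / L) ^ 2) := by gcongr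
    _ = _ := by rw [Real.exp_add]

lemma tendsto_sq_mul_geometric :
    Tendsto (fun k : ℕ => (k : ℝ) ^ 2 * (3 / 4 : ℝ) ^ (k / 2)) atTop (nhds 0) := by
  have h1 := (tendsto_pow_const_mul_const_pow_of_abs_lt_one 2
    (show |(3 / 4 : ℝ)| < 1 by norm_num [abs_of_pos])).const_mul 9
  rw [mul_zero] at h1
  have h2 : Tendsto (fun k : ℕ => k / 2) atTop atTop :=
    Filter.tendsto_atTop.2 fun b => (eventually_ge_atTop (2 * b)).mono fun k hk => by omega
  refine squeeze_zero' (Eventually.of_forall fun k => by positivity) ?_ (h1.comp h2)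
  filter_upwards [eventually_ge_atTop 2] with k hk
  have h3 : (k : ℝ) ≤ 3 * (k / 2 : ℕ) := by exact_mod_cast (by omega : k ≤ 3 * (k / 2))
  have h4 : (k : ℝ) ^ 2 ≤ 9 * ((k / 2 : ℕ) : ℝ) ^ 2 := by nlinarith [Nat.cast_nonneg (α := ℝ) k]
  calc (k : ℝ) ^ 2 * (3 / 4 : ℝ) ^ (k / 2)
      ≤ 9 * ((k / 2 : ℕ) : ℝ) ^ 2 * (3 / 4 : ℝ) ^ (k / 2) := by gcongr
    _ = _ := by simp only [Function.comp]; ring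

lemma tendsto_sq_mul_expect_half_pow {m : ℕ → ℕ} (hm : ∀ n : ℕ, 2 ≤ n → 2 ≤ m n ∧ m n ≤ n) :
    Tendsto (fun n : ℕ => (m n : ℝ) ^ 2 *
      𝔼 σ : Fin (m n) → Equiv.Perm (Fin n), (1 / 2 : ℝ) ^ (undom σ).card) atTop (nhds 0) := by
  have hnn : ∀ n : ℕ, 0 ≤ 𝔼 σ : Fin (m n) → Equiv.Perm (Fin n), (1 / 2 : ℝ) ^ (undom σ).card :=
    fun n => Finset.expect_nonneg fun σ _ => half_pow_nonneg _
  refine (nhds_basis_zero_abs_lt ℝ).tendsto_right_iff.2 fun ε hε => ?_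
  obtain ⟨M, hM⟩ := eventually_atTop.1 (tendsto_sq_mul_geometric.eventually_lt_const hε)
  have hs : Tendsto (fun n : ℕ => (M : ℝ) ^ 2 * (1 / √((n : ℝ) + 1))) atTop (nhds 0) := by
    have : Tendsto (fun n : ℕ => √((n : ℝ) + 1)) atTop atTop :=
      Real.tendsto_sqrt_atTop.comp
        (tendsto_atTop_add_const_right _ 1 tendsto_natCast_atTop_atTop)
    simpa using this.inv_tendsto_atTop.const_mul ((M : ℝ) ^ 2)
  filter_upwards [eventually_ge_atTop 2, hs.eventually_lt_const hε] with n hn hlt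
  obtain ⟨h2, hmn⟩ := hm n hn
  rw [abs_of_nonneg (mul_nonneg (sq_nonneg _) (hnn n))]
  rcases le_total M (m n) with h | h
  · refine lt_of_le_of_lt ?_ (hM (m n) h)
    exact mul_le_mul_of_nonneg_left (expect_half_pow_undom_le_geometric hmn) (sq_nonneg _)
  · refine lt_of_le_of_lt ?_ hlt
    have h' : (m n : ℝ) ≤ M := by exact_mod_cast h
    exact mul_le_mul (by gcongr) (expect_half_pow_undom_le_rsqrt h2) (hnn n) (sq_nonneg _)

lemma Pr_nonneg {m n : ℕ} (E : Set (Omega m n)) : 0 ≤ Pr E := by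
  unfold Pr; positivity

lemma tendsto_Pr_SR_lt {m : ℕ → ℕ} (hm : ∀ n : ℕ, 2 ≤ n → 2 ≤ m n ∧ m n ≤ n) :
    Tendsto (fun n : ℕ => Pr {ω : Omega (m n) n | SR ω < m n}) atTop (nhds 0) := by
  refine squeeze_zero' (Eventually.of_forall fun n => Pr_nonneg _) ?_
    (tendsto_sq_mul_expect_half_pow hm)
  filter_upwards [eventually_ge_atTop 2] with n hn
  exact Pr_SR_lt_le (by omega)

lemma tendsto_expSC_div_one {m : ℕ → ℕ} (hm : ∀ n : ℕ, 2 ≤ n → 2 ≤ m n ∧ m n ≤ n)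
    (h : Tendsto (fun n : ℕ => (m n : ℝ) - Real.logb 2 n) atTop atTop) :
    Tendsto (fun n : ℕ => expSC (m n) n / (n : ℝ)) atTop (nhds 1) := by
  have h1 : Tendsto (fun n : ℕ => (n : ℝ) * (1 / 2 : ℝ) ^ m n) atTop (nhds 0) := by
    have h2 := (tendsto_rpow_atTop_of_base_lt_one (1 / 2 : ℝ) (by norm_num) (by norm_num)).comp h
    refine h2.congr' ?_
    filter_upwards [eventually_gt_atTop 0] with n hn
    have hn' : (0 : ℝ) < n := by exact_mod_cast hn
    have h3 : (1 / 2 : ℝ) ^ Real.logb 2 n = (n : ℝ)⁻¹ := by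
      rw [one_div, Real.inv_rpow two_pos.le, Real.rpow_logb two_pos (by norm_num) hn']
    rw [Function.comp, Real.rpow_sub (by norm_num), h3, Real.rpow_natCast, div_inv_eq_mul,
      mul_comm]
  have h2 := (h1.const_sub 1).sub (tendsto_sq_mul_expect_half_pow hm)
  rw [sub_zero, sub_zero] at h2
  refine tendsto_of_tendsto_of_tendsto_of_le_of_le' h2 tendsto_const_nhds ?_ ?_
  · filter_upwards [eventually_ge_atTop 2] with n hn
    have hn' : (0 : ℝ) < n := by exact_mod_cast (by omega : 0 < n)
    have hb := sub_mul_le_expSC (n := n) (show 0 < m n by have := hm n hn; omega)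
    rw [le_div_iff₀ hn']
    linarith
  · filter_upwards [eventually_ge_atTop 2] with n hn
    have hn' : (0 : ℝ) < n := by exact_mod_cast (by omega : 0 < n)
    rw [div_le_one hn']
    exact expSC_le_card (by omega)

lemma sq_mul_factorial_div_pow_le {r : ℕ} {L : ℝ} (hr : 1 ≤ r) (hL : 0 < L)
    (hrL : 4 * ((r : ℝ) + 1) ≤ L) :
    ((r : ℝ) + 1) ^ 2 * (r.factorial / L ^ r) ≤ 4 * (((r : ℝ) + 1) / L) := by
  have hf : (r.factorial : ℝ) ≤ ((r : ℝ) + 1) ^ r := by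
    have h1 : r.factorial ≤ (r + 1) ^ r :=
      (Nat.factorial_le_pow r).trans (Nat.pow_le_pow_left (Nat.le_succ r) r)
    exact_mod_cast h1
  have h2 : ((r : ℝ) + 1) ^ 2 ≤ 4 ^ r := by
    have h3 : r + 1 ≤ 2 ^ r := Nat.lt_two_pow_self
    have h4 : ((r : ℝ) + 1) ≤ 2 ^ r := by exact_mod_cast h3
    calc ((r : ℝ) + 1) ^ 2 ≤ (2 ^ r) ^ 2 := by gcongr
      _ = 4 ^ r := by rw [← pow_mul, mul_comm, pow_mul]; norm_num
  have hq : 4 * (((r : ℝ) + 1) / L) ≤ 1 := by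
    rw [← mul_div_assoc, div_le_one hL]; exact hrL
  calc ((r : ℝ) + 1) ^ 2 * (r.factorial / L ^ r)
      ≤ 4 ^ r * (((r : ℝ) + 1) ^ r / L ^ r) := by gcongr
    _ = (4 * (((r : ℝ) + 1) / L)) ^ r := by rw [mul_pow, div_pow]
    _ ≤ (4 * (((r : ℝ) + 1) / L)) ^ 1 := pow_le_pow_of_le_one (by positivity) hq hr
    _ = _ := pow_one _

lemma normalized_expSC_le {m n : ℕ} (hm : 2 ≤ m) (hL : 0 < Real.log n)
    (hmL : 4 * (m : ℝ) ≤ Real.log n) :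
    ((m - 1).factorial : ℝ) / Real.log n ^ (m - 1) * expSC m n
      ≤ Real.exp (m / Real.log n + 4 * (m / Real.log n) ^ 2) := by
  have hn : 0 < n := by
    rcases Nat.eq_zero_or_pos n with rfl | h
    · simp at hL
    · exact h
  have hc : ((m - 1 : ℕ) : ℝ) ≤ m := by exact_mod_cast Nat.sub_le m 1
  have h1 := expSC_le (m := m) (n := n) (by omega)
  rw [expect_card_undom_eq_hsum (by omega) hn] at h1
  calc ((m - 1).factorial : ℝ) / Real.log n ^ (m - 1) * expSC m n
      ≤ ((m - 1).factorial : ℝ) / Real.log n ^ (m - 1) * hsum (m - 1) n := by gcongr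
    _ ≤ Real.exp ((m - 1 : ℕ) / Real.log n + 4 * ((m - 1 : ℕ) / Real.log n) ^ 2) :=
        normalized_hsum_le hL (by have : (0 : ℝ) ≤ m := Nat.cast_nonneg m
                                  linarith)
    _ ≤ _ := by gcongr

lemma le_normalized_expSC {m n : ℕ} (hm : 2 ≤ m) (hL : 0 < Real.log n)
    (hmL : 4 * (m : ℝ) ≤ Real.log n) :
    1 - 4 * (m / Real.log n) ≤ ((m - 1).factorial : ℝ) / Real.log n ^ (m - 1) * expSC m n := by
  have hn : 0 < n := by
    rcases Nat.eq_zero_or_pos n with rfl | h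
    · simp at hL
    · exact h
  have h1 := sub_sq_le_expSC (m := m) (n := n) (by omega)
  rw [expect_card_undom_eq_hsum (by omega) hn] at h1
  obtain ⟨r, rfl⟩ : ∃ r, m = r + 1 := ⟨m - 1, by omega⟩
  rw [Nat.add_sub_cancel] at *
  push_cast at *
  have h2 := sq_mul_factorial_div_pow_le (r := r) (by omega) hL hmL
  have h3 := le_normalized_hsum (r := r) hL
  calc 1 - 4 * (((r : ℝ) + 1) / Real.log n)
      ≤ r.factorial / Real.log n ^ r * (hsum r n - ((r : ℝ) + 1) ^ 2) := by
        rw [mul_sub]; linarith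
    _ ≤ _ := by gcongr

lemma expSC_div_le {m n : ℕ} (hm : 2 ≤ m) (hL : 0 < Real.log n)
    (hmL : 4 * (m : ℝ) ≤ Real.log n) :
    expSC m n / n ≤ Real.exp (1 / 2 - Real.log n / 4) := by
  have h1 := normalized_expSC_le hm hL hmL
  set L := Real.log n with hLdef
  set r := m - 1 with hr
  have hn : (0 : ℝ) < n := by
    rcases Nat.eq_zero_or_pos n with rfl | h
    · simp [hLdef] at hL
    · exact_mod_cast h
  have hq : (m : ℝ) / L ≤ 1 / 4 := by
    rw [div_le_div_iff₀ hL (by norm_num)]; linarith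
  have hq0 : 0 ≤ (m : ℝ) / L := by positivity
  have h2 : (r.factorial : ℝ) / L ^ r * expSC m n ≤ Real.exp (1 / 2) :=
    h1.trans (Real.exp_le_exp.2 (by nlinarith))
  have h3 : L ^ r / r.factorial ≤ Real.exp (L / 4) * Real.exp (L / 2) := by
    have h4 : (2 : ℝ) ^ r ≤ Real.exp (L / 4) := by
      have hrm : (r : ℝ) ≤ m := by exact_mod_cast Nat.sub_le m 1
      calc (2 : ℝ) ^ r ≤ Real.exp 1 ^ r := by
            gcongr; have := Real.add_one_le_exp 1; linarith
        _ = Real.exp r := by rw [← Real.exp_nat_mul, mul_one]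
        _ ≤ _ := Real.exp_le_exp.2 (by linarith)
    have h5 := Real.pow_div_factorial_le_exp (L / 2) (by positivity) r
    calc L ^ r / r.factorial = 2 ^ r * ((L / 2) ^ r / r.factorial) := by
          rw [div_pow]; field_simp
      _ ≤ _ := by gcongr
  have hf : (0 : ℝ) < r.factorial := by positivity
  rw [div_le_iff₀ hn]
  calc expSC m n = L ^ r / r.factorial * (r.factorial / L ^ r * expSC m n) := by field_simp
    _ ≤ L ^ r / r.factorial * Real.exp (1 / 2) := by gcongr
    _ ≤ Real.exp (L / 4) * Real.exp (L / 2) * Real.exp (1 / 2) := by gcongr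
    _ = Real.exp (1 / 2 - L / 4) * Real.exp L := by
        rw [← Real.exp_add, ← Real.exp_add, ← Real.exp_add]; congr 1; ring
    _ = _ := by rw [hLdef, Real.exp_log hn]

lemma eventually_small_ratio {m : ℕ → ℕ}
    (h : Tendsto (fun n : ℕ => (m n : ℝ) / Real.log n) atTop (nhds 0)) :
    ∀ᶠ n : ℕ in atTop, 0 < Real.log n ∧ 4 * (m n : ℝ) ≤ Real.log n := by
  filter_upwards [h.eventually_lt_const (show (0 : ℝ) < 1 / 4 by norm_num),
    eventually_ge_atTop 2] with n hn h2
  have hL : 0 < Real.log n := Real.log_pos (by exact_mod_cast h2)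
  rw [div_lt_iff₀ hL] at hn
  exact ⟨hL, by linarith⟩

lemma tendsto_normalized_expSC {m : ℕ → ℕ} (hm : ∀ n : ℕ, 2 ≤ n → 2 ≤ m n ∧ m n ≤ n)
    (h : Tendsto (fun n : ℕ => (m n : ℝ) / Real.log n) atTop (nhds 0)) :
    Tendsto (fun n : ℕ => ((m n - 1).factorial : ℝ) / Real.log n ^ (m n - 1) * expSC (m n) n)
      atTop (nhds 1) := by
  have hlo := (h.const_mul 4).const_sub 1
  have hhi := (h.add ((h.pow 2).const_mul 4)).rexp
  norm_num at hlo hhi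
  refine tendsto_of_tendsto_of_tendsto_of_le_of_le' hlo hhi ?_ ?_
  · filter_upwards [eventually_ge_atTop 2, eventually_small_ratio h] with n hn hL
    exact le_normalized_expSC (hm n hn).1 hL.1 hL.2
  · filter_upwards [eventually_ge_atTop 2, eventually_small_ratio h] with n hn hL
    exact normalized_expSC_le (hm n hn).1 hL.1 hL.2

lemma expSC_nonneg (m n : ℕ) : 0 ≤ expSC m n := by
  unfold expSC; positivity

lemma tendsto_expSC_div_zero {m : ℕ → ℕ} (hm : ∀ n : ℕ, 2 ≤ n → 2 ≤ m n ∧ m n ≤ n)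
    (h : Tendsto (fun n : ℕ => (m n : ℝ) / Real.log n) atTop (nhds 0)) :
    Tendsto (fun n : ℕ => expSC (m n) n / (n : ℝ)) atTop (nhds 0) := by
  have hlog : Tendsto (fun n : ℕ => Real.log n / 4) atTop atTop :=
    (Real.tendsto_log_atTop.comp tendsto_natCast_atTop_atTop).atTop_div_const (by norm_num)
  refine squeeze_zero' (Eventually.of_forall fun n =>
    div_nonneg (expSC_nonneg _ _) (Nat.cast_nonneg n)) ?_
    (Real.tendsto_exp_atBot.comp (tendsto_atBot_add_const_left _ (1 / 2 : ℝ)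
      (tendsto_neg_atTop_atBot.comp hlog)))
  filter_upwards [eventually_ge_atTop 2, eventually_small_ratio h] with n hn hL
  simpa [sub_eq_add_neg] using expSC_div_le (hm n hn).1 hL.1 hL.2

end

end UndominatedActions

/-- Let `2 ≤ m(n) ≤ n` for all `n ≥ 2`. Then (1) `Pr(S^R(m(n),n) < m(n)) → 0`;
(2) if `m(n)/ln n → 0` then `((m(n)−1)!/(ln n)^(m(n)−1))·E[S^C(m(n),n)] → 1` and
`E[S^C(m(n),n)]/n → 0`; (3) if `m(n) − log₂ n → ∞` then `E[S^C(m(n),n)]/n → 1`. -/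
theorem stmt17 (m : ℕ → ℕ) (hm : ∀ n : ℕ, 2 ≤ n → 2 ≤ m n ∧ m n ≤ n) :
    Filter.Tendsto (fun n : ℕ => Pr {ω : Omega (m n) n | SR ω < m n})
      Filter.atTop (nhds 0) ∧
    (Filter.Tendsto (fun n : ℕ => (m n : ℝ) / Real.log n) Filter.atTop (nhds 0) →
      Filter.Tendsto
        (fun n : ℕ => ((Nat.factorial (m n - 1) : ℝ) / (Real.log n) ^ (m n - 1)) *
          expSC (m n) n) Filter.atTop (nhds 1) ∧
      Filter.Tendsto (fun n : ℕ => expSC (m n) n / (n : ℝ)) Filter.atTop (nhds 0)) ∧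
    (Filter.Tendsto (fun n : ℕ => (m n : ℝ) - Real.logb 2 n) Filter.atTop Filter.atTop →
      Filter.Tendsto (fun n : ℕ => expSC (m n) n / (n : ℝ)) Filter.atTop (nhds 1)) :=
  ⟨UndominatedActions.tendsto_Pr_SR_lt hm,
    fun h => ⟨UndominatedActions.tendsto_normalized_expSC hm h,
      UndominatedActions.tendsto_expSC_div_zero hm h⟩,
    UndominatedActions.tendsto_expSC_div_one hm⟩
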